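/- Suppose p satisfies condition (A) at a with some exponent k > 0 and coefficient β_k > 0, and let λ ≤ 0. Then S_λ(p) = p₀·S, and the infimum is not attained: every nonzero u ∈ C_c^∞(Ω) satisfies ∫_Ω p|∇u|² dx − λ∫_Ω u² dx > p₀·S·(∫_Ω |u|^q dx)^{2/q}. -/

import Mathlib

open MeasureTheory Filter Asymptotics
open scoped Topology

noncomputable section

/-- Euclidean space `ℝⁿ`. -/
abbrev Euc (n : ℕ) := EuclideanSpace ℝ (Fin n)

/-- `u ∈ C_c^∞(Ω)`, `u ≢ 0`. -/
def IsTest {n : ℕ} (Ω : Set (Euc n)) (u : Euc n → ℝ) : Prop :=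
  ContDiff ℝ (⊤ : ℕ∞) u ∧ HasCompactSupport u ∧ tsupport u ⊆ Ω ∧ u ≠ 0

/-- Condition (A): `lim_{x→a} (p(x) - p₀)/|x-a|^k = β`. -/
def CondA {n : ℕ} (p : Euc n → ℝ) (a : Euc n) (p₀ k β : ℝ) : Prop :=
  Tendsto (fun x => (p x - p₀) / ‖x - a‖ ^ k) (𝓝[≠] a) (𝓝 β)

/-- The best Sobolev constant
`S = inf { ∫_Ω |∇u|² / (∫_Ω |u|^q)^{2/q} : u ∈ C_c^∞(Ω), u ≢ 0 }`. -/
def SobolevS {n : ℕ} (Ω : Set (Euc n)) (q : ℝ) : ℝ :=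
  sInf {r : ℝ | ∃ u : Euc n → ℝ, IsTest Ω u ∧
    r = (∫ x in Ω, ‖gradient u x‖ ^ 2) / (∫ x in Ω, |u x| ^ q) ^ (2 / q)}

/-- `S_λ(p) = inf { (∫_Ω p|∇u|² - λ∫_Ω u²) / (∫_Ω |u|^q)^{2/q} : u ∈ C_c^∞(Ω), u ≢ 0 }`. -/
def Slam {n : ℕ} (Ω : Set (Euc n)) (p : Euc n → ℝ) (q lam : ℝ) : ℝ :=
  sInf {r : ℝ | ∃ u : Euc n → ℝ, IsTest Ω u ∧
    r = ((∫ x in Ω, p x * ‖gradient u x‖ ^ 2) - lam * ∫ x in Ω, (u x) ^ 2) /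
        (∫ x in Ω, |u x| ^ q) ^ (2 / q)}

section Auxiliary

variable {n : ℕ} {Ω : Set (Euc n)} {u : Euc n → ℝ} {q : ℝ}

lemma norm_gradient_eq_norm_fderiv (u : Euc n → ℝ) (x : Euc n) :
    ‖gradient u x‖ = ‖fderiv ℝ u x‖ := by
  simp [gradient]

lemma continuous_norm_gradient_sq (hu : ContDiff ℝ (⊤ : ℕ∞) u) :
    Continuous fun x => ‖gradient u x‖ ^ 2 := by
  simp_rw [norm_gradient_eq_norm_fderiv]
  exact (hu.continuous_fderiv (by simp)).norm.pow 2

lemma hasCompactSupport_norm_gradient_sq (hu : HasCompactSupport u) :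
    HasCompactSupport fun x => ‖gradient u x‖ ^ 2 := by
  simp_rw [norm_gradient_eq_norm_fderiv]
  exact (hu.fderiv ℝ).comp_left (g := fun L => ‖L‖ ^ 2) (by simp)

lemma hasCompactSupport_abs_rpow (hq : 0 < q) (hu : HasCompactSupport u) :
    HasCompactSupport fun x => |u x| ^ q :=
  hu.comp_left (g := fun t : ℝ => |t| ^ q) (by simp [hq.ne'])

lemma continuous_abs_rpow (hq : 0 < q) (hu : Continuous u) :
    Continuous fun x => |u x| ^ q :=
  hu.abs.rpow_const fun _ => Or.inr hq.le

lemma gradient_eq_zero_of_notMem_tsupport {x : Euc n} (hx : x ∉ tsupport u) :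
    gradient u x = 0 := by
  have : fderiv ℝ u x = 0 := by
    by_contra h
    exact hx (support_fderiv_subset ℝ h)
  simp [gradient, this]

lemma gradient_ne_zero_of_hasCompactSupport (hn : 0 < n) (hu : ContDiff ℝ (⊤ : ℕ∞) u)
    (hc : HasCompactSupport u) (h0 : u ≠ 0) : ∃ x, gradient u x ≠ 0 := by
  by_contra! h
  have hf : ∀ x, fderiv ℝ u x = 0 := fun x => by
    have := norm_gradient_eq_norm_fderiv u x
    rw [h x, norm_zero] at this
    exact norm_eq_zero.1 this.symm
  have hconst := is_const_of_fderiv_eq_zero (hu.differentiable (by simp)) hf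
  have : Nonempty (Fin n) := ⟨⟨0, hn⟩⟩
  have hne : tsupport u ≠ Set.univ := fun h' => by
    have hcu : IsCompact (Set.univ : Set (Euc n)) := h' ▸ hc.isCompact
    exact noncompact_univ _ hcu
  obtain ⟨y, hy⟩ := (Set.ne_univ_iff_exists_notMem _).1 hne
  exact h0 (funext fun x => (hconst x y).trans (image_eq_zero_of_notMem_tsupport hy))

lemma setIntegral_eq_integral_of_tsupport_subset {f : Euc n → ℝ} (hs : tsupport u ⊆ Ω)
    (hf : ∀ x, x ∉ tsupport u → f x = 0) : ∫ x in Ω, f x = ∫ x, f x :=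
  setIntegral_eq_integral_of_forall_compl_eq_zero fun x hx => hf x fun h => hx (hs h)

lemma IsTest.setIntegral_gradient (hu : IsTest Ω u) :
    ∫ x in Ω, ‖gradient u x‖ ^ 2 = ∫ x, ‖gradient u x‖ ^ 2 :=
  setIntegral_eq_integral_of_tsupport_subset hu.2.2.1 fun x hx => by
    simp [gradient_eq_zero_of_notMem_tsupport hx]

lemma IsTest.setIntegral_abs_rpow (hq : 0 < q) (hu : IsTest Ω u) :
    ∫ x in Ω, |u x| ^ q = ∫ x, |u x| ^ q :=
  setIntegral_eq_integral_of_tsupport_subset hu.2.2.1 fun x hx => by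
    simp [image_eq_zero_of_notMem_tsupport hx, hq.ne']

lemma IsTest.setIntegral_sq (hu : IsTest Ω u) :
    ∫ x in Ω, (u x) ^ 2 = ∫ x, (u x) ^ 2 :=
  setIntegral_eq_integral_of_tsupport_subset hu.2.2.1 fun x hx => by
    simp [image_eq_zero_of_notMem_tsupport hx]

lemma IsTest.integral_abs_rpow_pos (hq : 0 < q) (hu : IsTest Ω u) :
    0 < ∫ x, |u x| ^ q := by
  obtain ⟨x, hx⟩ := Function.ne_iff.1 hu.2.2.2
  refine (continuous_abs_rpow hq hu.1.continuous).integral_pos_of_hasCompactSupport_nonneg_nonzero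
    (hasCompactSupport_abs_rpow hq hu.2.1) (fun y => by positivity) (x := x) ?_
  exact (Real.rpow_pos_of_pos (abs_pos.2 hx) q).ne'

lemma IsTest.sobolev_le (hq : 0 < q) (hu : IsTest Ω u) :
    SobolevS Ω q * (∫ x, |u x| ^ q) ^ (2 / q) ≤ ∫ x, ‖gradient u x‖ ^ 2 := by
  have hB := Real.rpow_pos_of_pos (hu.integral_abs_rpow_pos hq) (2 / q)
  rw [← le_div_iff₀ hB, ← hu.setIntegral_gradient, ← hu.setIntegral_abs_rpow hq]
  refine csInf_le ⟨0, ?_⟩ ⟨u, hu, rfl⟩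
  rintro r ⟨v, hv, rfl⟩
  positivity

lemma exists_smooth_cutoff (hΩ : IsOpen Ω) {K : Set (Euc n)} (hK : IsCompact K) (hKΩ : K ⊆ Ω) :
    ∃ φ : Euc n → ℝ, ContDiff ℝ (⊤ : ℕ∞) φ ∧ HasCompactSupport φ ∧ tsupport φ ⊆ Ω ∧
      (∀ x ∈ K, φ x = 1) ∧ ∀ x, φ x ∈ Set.Icc (0 : ℝ) 1 := by
  obtain ⟨L, hL, hKL, hLΩ⟩ := exists_compact_between hK hΩ hKΩ
  obtain ⟨f, h1, h0, hf⟩ := exists_contMDiffMap_one_nhds_of_subset_interior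
    (n := (⊤ : ℕ∞)) (modelWithCornersSelf ℝ (Euc n)) hK.isClosed hKL
  have hsub : tsupport f ⊆ L :=
    closure_minimal (fun x hx => by_contra fun h => hx (h0 x h)) hL.isClosed
  exact ⟨f, f.contMDiff.contDiff, hL.of_isClosed_subset (isClosed_tsupport _) hsub,
    hsub.trans hLΩ, fun x hx => h1.self_of_nhdsSet x hx, hf⟩

lemma not_forall_rpow_increment_le {r B C S M : ℝ} (hr : 0 < r) (hr1 : r < 1) (hB : 0 ≤ B)
    (hC : 0 < C) (hS : 0 < S) :
    ¬ ∀ s ∈ Set.Ioc (0 : ℝ) 1, S * (B + s * C) ^ r ≤ S * B ^ r + M * s ^ 2 := by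
  intro h
  have hD : 0 < (B + C) ^ r - B ^ r :=
    sub_pos.2 (Real.rpow_lt_rpow hB (by linarith) hr)
  have key : ∀ s ∈ Set.Ioc (0 : ℝ) 1, S * ((B + C) ^ r - B ^ r) ≤ M * s := fun s hs => by
    have hconc := (Real.concaveOn_rpow hr.le hr1.le).2 (x := B) (y := B + C) hB
      (by simp only [Set.mem_Ici]; linarith) (sub_nonneg.2 hs.2) hs.1.le (by ring)
    simp only [smul_eq_mul] at hconc
    rw [show (1 - s) * B + s * (B + C) = B + s * C by ring] at hconc
    have h2 := h s hs
    have h3 := mul_le_mul_of_nonneg_left hconc hS.le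
    have : s * (S * ((B + C) ^ r - B ^ r)) ≤ s * (M * s) := by nlinarith
    exact le_of_mul_le_mul_left this hs.1
  have hP := mul_pos hS hD
  have hM : 0 < M := by have := key 1 (by simp); linarith
  set P := S * ((B + C) ^ r - B ^ r)
  have hs : min 1 (P / (2 * M)) ∈ Set.Ioc (0 : ℝ) 1 :=
    ⟨lt_min one_pos (by positivity), min_le_left _ _⟩
  have h4 := (key _ hs).trans (mul_le_mul_of_nonneg_left (min_le_right _ _) hM.le)
  have h5 : M * (P / (2 * M)) = P / 2 := by field_simp
  linarith

/-- A smooth competitor lying above `|u| + s` on the support of `u`. -/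
def liftedTest (u φ : Euc n → ℝ) (s : ℝ) (x : Euc n) : ℝ :=
  Real.sqrt (u x ^ 2 + s ^ 2) - s + 2 * s * φ x

section LiftedTest

variable {φ : Euc n → ℝ} {s : ℝ}

lemma liftedTest_of_notMem_tsupport (hs : 0 < s) {x : Euc n} (hx : x ∉ tsupport u) :
    liftedTest u φ s x = 2 * s * φ x := by
  simp [liftedTest, image_eq_zero_of_notMem_tsupport hx, Real.sqrt_sq hs.le]

lemma contDiff_liftedTest (hs : 0 < s) (hu : ContDiff ℝ (⊤ : ℕ∞) u)
    (hφ : ContDiff ℝ (⊤ : ℕ∞) φ) : ContDiff ℝ (⊤ : ℕ∞) (liftedTest u φ s) :=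
  ((((hu.pow 2).add contDiff_const).sqrt fun x => by positivity).sub contDiff_const).add
    (contDiff_const.mul hφ)

lemma le_liftedTest {x : Euc n} (hx : φ x = 1) : |u x| + s ≤ liftedTest u φ s x := by
  have : |u x| ≤ Real.sqrt (u x ^ 2 + s ^ 2) := Real.abs_le_sqrt (by nlinarith [sq_nonneg s])
  rw [liftedTest, hx]
  linarith

lemma isTest_liftedTest (hs : 0 < s) (hu : IsTest Ω u) (hφ : ContDiff ℝ (⊤ : ℕ∞) φ)
    (hφc : HasCompactSupport φ) (hφΩ : tsupport φ ⊆ Ω) (hφ1 : ∀ x ∈ tsupport u, φ x = 1) :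
    IsTest Ω (liftedTest u φ s) := by
  have huφ : tsupport u ⊆ tsupport φ := fun x hx =>
    subset_tsupport _ (by simp [hφ1 x hx])
  have hsub : tsupport (liftedTest u φ s) ⊆ tsupport φ := by
    refine closure_minimal (fun x hx => by_contra fun h => hx ?_) (isClosed_tsupport _)
    rw [liftedTest_of_notMem_tsupport hs fun h' => h (huφ h'),
      image_eq_zero_of_notMem_tsupport h, mul_zero]
  refine ⟨contDiff_liftedTest hs hu.1 hφ, hφc.of_isClosed_subset (isClosed_tsupport _) hsub,
    hsub.trans hφΩ, fun h0 => ?_⟩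
  obtain ⟨x, hx⟩ := Function.ne_iff.1 hu.2.2.2
  have h1 := le_liftedTest (u := u) (s := s) (hφ1 x (subset_tsupport _ hx))
  rw [h0] at h1
  have := abs_nonneg (u x)
  simp only [Pi.zero_apply] at h1
  linarith

lemma norm_gradient_liftedTest_sq_le (hs : 0 < s) (hu : ContDiff ℝ (⊤ : ℕ∞) u)
    (hφ : ContDiff ℝ (⊤ : ℕ∞) φ) (hφ1 : ∀ x ∈ tsupport u, φ x = 1) (hφI : ∀ x, φ x ≤ 1)
    (x : Euc n) :
    ‖gradient (liftedTest u φ s) x‖ ^ 2 ≤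
      ‖gradient u x‖ ^ 2 + 4 * s ^ 2 * ‖gradient φ x‖ ^ 2 := by
  simp_rw [norm_gradient_eq_norm_fderiv]
  have hφd : DifferentiableAt ℝ φ x := hφ.differentiable (by simp) x
  have hud : DifferentiableAt ℝ u x := hu.differentiable (by simp) x
  by_cases hx : x ∈ tsupport u
  · have hmax : IsLocalMax φ x := Eventually.of_forall fun y => (hφI y).trans (hφ1 x hx).ge
    have hd0 : HasFDerivAt φ (0 : Euc n →L[ℝ] ℝ) x := hmax.fderiv_eq_zero ▸ hφd.hasFDerivAt
    have hpos : 0 < u x ^ 2 + s ^ 2 := by positivity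
    have hd := ((((hud.hasFDerivAt.pow 2).add_const (s ^ 2)).sqrt hpos.ne').sub_const s).add
      (hd0.const_mul (2 * s))
    have hd' : fderiv ℝ (liftedTest u φ s) x =
        (u x / Real.sqrt (u x ^ 2 + s ^ 2)) • fderiv ℝ u x := by
      refine (HasFDerivAt.fderiv hd).trans ?_
      ext y
      simp
      field_simp
    rw [hd', norm_smul, mul_pow, Real.norm_eq_abs, sq_abs, div_pow, Real.sq_sqrt hpos.le]
    have h1 : u x ^ 2 / (u x ^ 2 + s ^ 2) ≤ 1 :=
      (div_le_one hpos).2 (by nlinarith [sq_nonneg s])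
    have h2 := mul_le_mul_of_nonneg_right h1 (sq_nonneg ‖fderiv ℝ u x‖)
    have h3 : 0 ≤ 4 * s ^ 2 * ‖fderiv ℝ φ x‖ ^ 2 := by positivity
    linarith
  · have hev : liftedTest u φ s =ᶠ[𝓝 x] fun y => 2 * s * φ y :=
      eventually_of_mem ((isClosed_tsupport u).isOpen_compl.mem_nhds hx)
        fun y hy => liftedTest_of_notMem_tsupport hs hy
    rw [hev.fderiv_eq, fderiv_const_mul hφd, norm_smul, mul_pow, Real.norm_eq_abs, sq_abs]
    nlinarith [sq_nonneg ‖fderiv ℝ u x‖]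

lemma integral_abs_liftedTest_rpow_ge (hq : 1 < q) (hs : 0 < s) (hu : IsTest Ω u)
    (hw : IsTest Ω (liftedTest u φ s)) (hφ1 : ∀ x ∈ tsupport u, φ x = 1) :
    (∫ x, |u x| ^ q) + s * ∫ x, |u x| ^ (q - 1) ≤ ∫ x, |liftedTest u φ s x| ^ q := by
  have hq0 : 0 < q := by linarith
  have hq1 : 0 < q - 1 := by linarith
  have hi1 := (continuous_abs_rpow hq0 hu.1.continuous).integrable_of_hasCompactSupport (μ := volume)
    (hasCompactSupport_abs_rpow hq0 hu.2.1)
  have hi2 := (continuous_abs_rpow hq1 hu.1.continuous).integrable_of_hasCompactSupport (μ := volume)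
    (hasCompactSupport_abs_rpow hq1 hu.2.1)
  rw [← integral_const_mul, ← integral_add hi1 (hi2.const_mul s)]
  refine integral_mono (hi1.add (hi2.const_mul s))
    ((continuous_abs_rpow hq0 hw.1.continuous).integrable_of_hasCompactSupport
      (hasCompactSupport_abs_rpow hq0 hw.2.1)) fun x => ?_
  by_cases hx : x ∈ tsupport u
  · have h1 := (le_liftedTest (u := u) (s := s) (hφ1 x hx)).trans (le_abs_self _)
    have h0 := abs_nonneg (u x)
    have hsplit : ∀ t : ℝ, 0 ≤ t → t ^ q = t * t ^ (q - 1) := fun t ht => by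
      rw [← Real.rpow_one_add' ht (by linarith)]
      congr 1
      ring
    rw [hsplit _ h0, hsplit _ (abs_nonneg _), ← add_mul]
    exact mul_le_mul h1 (Real.rpow_le_rpow h0 (by linarith) hq1.le) (by positivity)
      (abs_nonneg _)
  · rw [image_eq_zero_of_notMem_tsupport hx, abs_zero, Real.zero_rpow hq0.ne',
      Real.zero_rpow hq1.ne', mul_zero, add_zero]
    positivity

end LiftedTest

lemma SobolevS_nonneg : 0 ≤ SobolevS Ω q := by
  refine Real.sInf_nonneg ?_
  rintro r ⟨v, hv, rfl⟩
  positivity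

/-- The best Sobolev constant is not attained in `C_c^∞(Ω)`. -/
lemma IsTest.sobolev_lt (hn : 0 < n) (hΩ : IsOpen Ω) (hq : 2 < q) (hu : IsTest Ω u) :
    SobolevS Ω q * (∫ x, |u x| ^ q) ^ (2 / q) < ∫ x, ‖gradient u x‖ ^ 2 := by
  have hq0 : 0 < q := by linarith
  refine (hu.sobolev_le hq0).lt_of_ne fun heq => ?_
  rcases (SobolevS_nonneg (Ω := Ω) (q := q)).eq_or_lt with hS | hS
  · obtain ⟨x, hx⟩ := gradient_ne_zero_of_hasCompactSupport hn hu.1 hu.2.1 hu.2.2.2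
    have := (continuous_norm_gradient_sq hu.1).integral_pos_of_hasCompactSupport_nonneg_nonzero
      (μ := volume) (hasCompactSupport_norm_gradient_sq hu.2.1) (fun y => by positivity) (x := x)
      (by simpa using hx)
    rw [← hS, zero_mul] at heq
    exact this.ne heq
  obtain ⟨φ, hφ, hφc, hφΩ, hφ1, hφI⟩ := exists_smooth_cutoff hΩ hu.2.1.isCompact hu.2.2.1
  refine not_forall_rpow_increment_le (r := 2 / q) (B := ∫ x, |u x| ^ q)
    (C := ∫ x, |u x| ^ (q - 1)) (S := SobolevS Ω q) (M := 4 * ∫ x, ‖gradient φ x‖ ^ 2)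
    (by positivity) ((div_lt_one hq0).2 hq) (hu.integral_abs_rpow_pos hq0).le
    (hu.integral_abs_rpow_pos (by linarith)) hS fun s hs => ?_
  have hw := isTest_liftedTest hs.1 hu hφ hφc hφΩ hφ1
  have hB := integral_abs_liftedTest_rpow_ge (q := q) (by linarith) hs.1 hu hw hφ1
  have hi : ∀ {v : Euc n → ℝ}, ContDiff ℝ (⊤ : ℕ∞) v → HasCompactSupport v →
      Integrable fun x => ‖gradient v x‖ ^ 2 := fun hv hvc =>
    (continuous_norm_gradient_sq hv).integrable_of_hasCompactSupport
      (hasCompactSupport_norm_gradient_sq hvc)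
  have hA : ∫ x, ‖gradient (liftedTest u φ s) x‖ ^ 2 ≤
      (∫ x, ‖gradient u x‖ ^ 2) + 4 * s ^ 2 * ∫ x, ‖gradient φ x‖ ^ 2 := by
    rw [← integral_const_mul, ← integral_add (hi hu.1 hu.2.1) ((hi hφ hφc).const_mul _)]
    exact integral_mono (hi hw.1 hw.2.1) ((hi hu.1 hu.2.1).add ((hi hφ hφc).const_mul _))
      (norm_gradient_liftedTest_sq_le hs.1 hu.1 hφ hφ1 fun x => (hφI x).2)
  have hC : 0 ≤ ∫ x, |u x| ^ (q - 1) := integral_nonneg fun x => by positivity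
  have hB0 := (hu.integral_abs_rpow_pos hq0).le
  calc SobolevS Ω q * ((∫ x, |u x| ^ q) + s * ∫ x, |u x| ^ (q - 1)) ^ (2 / q)
      ≤ SobolevS Ω q * (∫ x, |liftedTest u φ s x| ^ q) ^ (2 / q) := by
        refine mul_le_mul_of_nonneg_left (Real.rpow_le_rpow ?_ hB (by positivity)) hS.le
        have := hs.1
        positivity
    _ ≤ ∫ x, ‖gradient (liftedTest u φ s) x‖ ^ 2 := hw.sobolev_le hq0
    _ ≤ _ := hA
    _ = _ := by rw [heq]; ring

/-- The dilation `x ↦ u (a + c (x - a))` of `u` about `a`. -/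
def dilate (a : Euc n) (c : ℝ) (u : Euc n → ℝ) (x : Euc n) : ℝ := u (a + c • (x - a))

section Dilate

variable {a : Euc n} {c : ℝ}

lemma integral_comp_dilation (hc : 0 < c) (F : Euc n → ℝ) :
    ∫ x, F (a + c • (x - a)) = (c ^ n)⁻¹ * ∫ x, F x := by
  rw [integral_sub_right_eq_self (fun x => F (a + c • x)) a,
    Measure.integral_comp_smul volume (fun x => F (a + x)) c,
    integral_add_left_eq_self F a, smul_eq_mul, finrank_euclideanSpace_fin,
    abs_of_pos (by positivity)]

lemma norm_gradient_dilate (hc : 0 < c) (hu : ContDiff ℝ (⊤ : ℕ∞) u) (x : Euc n) :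
    ‖gradient (dilate a c u) x‖ = c * ‖gradient u (a + c • (x - a))‖ := by
  simp_rw [norm_gradient_eq_norm_fderiv]
  have h1 : HasFDerivAt (fun y : Euc n => a + c • (y - a))
      (c • ContinuousLinearMap.id ℝ (Euc n)) x :=
    (((hasFDerivAt_id x).sub_const a).const_smul c).const_add a
  have h2 := ((hu.differentiable (by simp) (a + c • (x - a))).hasFDerivAt).comp x h1
  have h3 : fderiv ℝ (dilate a c u) x = c • fderiv ℝ u (a + c • (x - a)) := by
    refine (HasFDerivAt.fderiv h2).trans ?_
    ext y
    simp
  rw [h3, norm_smul, Real.norm_of_nonneg hc.le]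

lemma tsupport_dilate_subset (u : Euc n → ℝ) :
    tsupport (dilate a c u) ⊆ (fun x => a + c • (x - a)) ⁻¹' tsupport u :=
  closure_minimal (fun _ hx => subset_tsupport _ hx)
    ((isClosed_tsupport u).preimage (by fun_prop))

lemma tsupport_dilate_subset_closedBall {R : ℝ} (hc : 0 < c)
    (hR : tsupport u ⊆ Metric.closedBall a R) :
    tsupport (dilate a c u) ⊆ Metric.closedBall a (R / c) := fun x hx => by
  have := hR (tsupport_dilate_subset u hx)
  rw [mem_closedBall_iff_norm, add_sub_cancel_left, norm_smul, Real.norm_of_nonneg hc.le] at this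
  rw [mem_closedBall_iff_norm, le_div_iff₀ hc]
  linarith

lemma isTest_dilate {R : ℝ} (hc : 0 < c) (hu : IsTest Ω u)
    (hR : tsupport u ⊆ Metric.closedBall a R) (hΩ : Metric.closedBall a (R / c) ⊆ Ω) :
    IsTest Ω (dilate a c u) := by
  have hsub := tsupport_dilate_subset_closedBall hc hR
  refine ⟨hu.1.comp (by fun_prop), (isCompact_closedBall _ _).of_isClosed_subset
    (isClosed_tsupport _) hsub, hsub.trans hΩ, fun h => hu.2.2.2 (funext fun x => ?_)⟩
  have := congrFun h (a + c⁻¹ • (x - a))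
  simpa [dilate, smul_smul, hc.ne'] using this

lemma integral_norm_gradient_dilate (hc : 0 < c) (hu : ContDiff ℝ (⊤ : ℕ∞) u) :
    ∫ x, ‖gradient (dilate a c u) x‖ ^ 2 =
      c ^ 2 * ((c ^ n)⁻¹ * ∫ x, ‖gradient u x‖ ^ 2) := by
  simp_rw [norm_gradient_dilate hc hu, mul_pow]
  rw [integral_const_mul, integral_comp_dilation hc fun x => ‖gradient u x‖ ^ 2]

lemma integral_abs_dilate_rpow (hn : 3 ≤ n) (hq : q = 2 * (n : ℝ) / ((n : ℝ) - 2)) (hc : 0 < c) :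
    (∫ x, |dilate a c u x| ^ q) ^ (2 / q) =
      c ^ 2 * (c ^ n)⁻¹ * (∫ x, |u x| ^ q) ^ (2 / q) := by
  have hn' : (3 : ℝ) ≤ n := by exact_mod_cast hn
  have hn2 : (n : ℝ) - 2 ≠ 0 := by linarith
  simp only [dilate]
  rw [integral_comp_dilation hc fun x => |u x| ^ q,
    Real.mul_rpow (by positivity) (integral_nonneg fun x => by positivity)]
  congr 1
  rw [← Real.rpow_natCast c n, ← Real.rpow_neg hc.le, ← Real.rpow_mul hc.le,
    ← Real.rpow_natCast c 2, ← Real.rpow_add hc]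
  congr 1
  rw [hq]
  push_cast
  field_simp
  ring

end Dilate

section Weighted

variable {p : Euc n → ℝ} {p₀ lam : ℝ} {a : Euc n}

lemma integrableOn_mul_norm_gradient_sq (hΩb : Bornology.IsBounded Ω)
    (hpc : ContinuousOn p (closure Ω)) (hu : ContDiff ℝ (⊤ : ℕ∞) u) :
    IntegrableOn (fun x => p x * ‖gradient u x‖ ^ 2) Ω :=
  ((hpc.mul (continuous_norm_gradient_sq hu).continuousOn).integrableOn_compact
    hΩb.isCompact_closure).mono_set subset_closure

lemma integrableOn_norm_gradient_sq (hu : ContDiff ℝ (⊤ : ℕ∞) u) (hc : HasCompactSupport u) :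
    IntegrableOn (fun x => ‖gradient u x‖ ^ 2) Ω :=
  ((continuous_norm_gradient_sq hu).integrable_of_hasCompactSupport
    (hasCompactSupport_norm_gradient_sq hc)).integrableOn

lemma IsTest.le_energy (hΩo : IsOpen Ω) (hΩb : Bornology.IsBounded Ω)
    (hpc : ContinuousOn p (closure Ω)) (hmin : ∀ x ∈ closure Ω, p₀ ≤ p x) (hlam : lam ≤ 0)
    (hu : IsTest Ω u) :
    p₀ * ∫ x, ‖gradient u x‖ ^ 2 ≤
      (∫ x in Ω, p x * ‖gradient u x‖ ^ 2) - lam * ∫ x in Ω, (u x) ^ 2 := by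
  have h1 : p₀ * ∫ x in Ω, ‖gradient u x‖ ^ 2 ≤ ∫ x in Ω, p x * ‖gradient u x‖ ^ 2 := by
    rw [← integral_const_mul]
    exact setIntegral_mono_on ((integrableOn_norm_gradient_sq hu.1 hu.2.1).const_mul p₀)
      (integrableOn_mul_norm_gradient_sq hΩb hpc hu.1) hΩo.measurableSet fun x hx =>
        mul_le_mul_of_nonneg_right (hmin x (subset_closure hx)) (sq_nonneg _)
  have h2 : 0 ≤ ∫ x in Ω, (u x) ^ 2 := integral_nonneg fun x => sq_nonneg _
  rw [hu.setIntegral_gradient] at h1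
  nlinarith

lemma IsTest.setIntegral_mul_gradient_le (hΩo : IsOpen Ω) (hΩb : Bornology.IsBounded Ω)
    (hpc : ContinuousOn p (closure Ω)) {M : ℝ} (hM : ∀ x ∈ tsupport u, p x ≤ M)
    (hu : IsTest Ω u) :
    ∫ x in Ω, p x * ‖gradient u x‖ ^ 2 ≤ M * ∫ x, ‖gradient u x‖ ^ 2 := by
  rw [← hu.setIntegral_gradient, ← integral_const_mul]
  refine setIntegral_mono_on (integrableOn_mul_norm_gradient_sq hΩb hpc hu.1)
    ((integrableOn_norm_gradient_sq hu.1 hu.2.1).const_mul M) hΩo.measurableSet fun x _ => ?_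
  by_cases hx : x ∈ tsupport u
  · exact mul_le_mul_of_nonneg_right (hM x hx) (sq_nonneg _)
  · simp [gradient_eq_zero_of_notMem_tsupport hx]

lemma Slam_le_energy_div (hΩo : IsOpen Ω) (hΩb : Bornology.IsBounded Ω)
    (hpc : ContinuousOn p (closure Ω)) (hp₀ : 0 ≤ p₀) (hmin : ∀ x ∈ closure Ω, p₀ ≤ p x)
    (hlam : lam ≤ 0) (hu : IsTest Ω u) :
    Slam Ω p q lam ≤ ((∫ x in Ω, p x * ‖gradient u x‖ ^ 2) - lam * ∫ x in Ω, (u x) ^ 2) /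
        (∫ x in Ω, |u x| ^ q) ^ (2 / q) := by
  refine csInf_le ⟨0, ?_⟩ ⟨u, hu, rfl⟩
  rintro r ⟨v, hv, rfl⟩
  have := hv.le_energy hΩo hΩb hpc hmin hlam
  have h1 : 0 ≤ p₀ * ∫ x, ‖gradient v x‖ ^ 2 := by positivity
  exact div_nonneg (h1.trans this) (by positivity)

/-- Concentrating a test function at a point `a` where `p` is minimal makes both the excess of the
weight `p` and the zeroth-order term negligible. -/
lemma IsTest.Slam_mul_le (hn : 3 ≤ n) (hq : q = 2 * (n : ℝ) / ((n : ℝ) - 2)) (hq0 : 0 < q)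
    (hΩo : IsOpen Ω) (hΩb : Bornology.IsBounded Ω) (ha : a ∈ Ω)
    (hpc : ContinuousOn p (closure Ω)) (hp₀ : 0 ≤ p₀) (hpa : p a = p₀)
    (hmin : ∀ x ∈ closure Ω, p₀ ≤ p x) (hlam : lam ≤ 0) (hu : IsTest Ω u) :
    Slam Ω p q lam * (∫ x, |u x| ^ q) ^ (2 / q) ≤ p₀ * ∫ x, ‖gradient u x‖ ^ 2 := by
  obtain ⟨R, hR⟩ := hu.2.1.isCompact.isBounded.subset_closedBall a
  set A := ∫ x, ‖gradient u x‖ ^ 2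
  set N := ∫ x, (u x) ^ 2
  have hA : 0 ≤ A := integral_nonneg fun x => by positivity
  have hB := Real.rpow_pos_of_pos (hu.integral_abs_rpow_pos hq0) (2 / q)
  have hcont : ContinuousAt p a :=
    (hpc.mono subset_closure).continuousAt (hΩo.mem_nhds ha)
  have hev : ∀ δ > 0, ∀ᶠ c : ℝ in atTop,
      Slam Ω p q lam * (∫ x, |u x| ^ q) ^ (2 / q) ≤ (p₀ + δ) * A - lam * N * (c ^ 2)⁻¹ := by
    intro δ hδ
    have hnear : ∀ᶠ x in 𝓝 a, x ∈ Ω ∧ p x < p₀ + δ :=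
      (hΩo.eventually_mem ha).and (hcont.eventually_lt continuousAt_const (by linarith))
    obtain ⟨ε, hε, hball⟩ := Metric.eventually_nhds_iff_ball.1 hnear
    have hlim : Tendsto (fun c : ℝ => R / c) atTop (𝓝 0) :=
      tendsto_const_nhds.div_atTop tendsto_id
    filter_upwards [hlim.eventually_lt_const hε, eventually_gt_atTop 0] with c hcε hc
    have hcb : Metric.closedBall a (R / c) ⊆ Metric.ball a ε := Metric.closedBall_subset_ball hcε
    have hv : IsTest Ω (dilate a c u) :=
      isTest_dilate hc hu hR fun x hx => (hball x (hcb hx)).1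
    have h1 := Slam_le_energy_div (q := q) hΩo hΩb hpc hp₀ hmin hlam hv
    have hBv := Real.rpow_pos_of_pos (hv.integral_abs_rpow_pos hq0) (2 / q)
    rw [hv.setIntegral_abs_rpow hq0, le_div_iff₀ hBv, hv.setIntegral_sq] at h1
    have h2 := hv.setIntegral_mul_gradient_le hΩo hΩb hpc (M := p₀ + δ) fun x hx =>
      (hball x (hcb (tsupport_dilate_subset_closedBall hc hR hx))).2.le
    have hN : ∫ x, (dilate a c u x) ^ 2 = (c ^ n)⁻¹ * N :=
      integral_comp_dilation hc fun x => u x ^ 2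
    rw [integral_norm_gradient_dilate hc hu.1] at h2
    rw [hN, integral_abs_dilate_rpow hn hq hc] at h1
    have hk : 0 < c ^ 2 * (c ^ n)⁻¹ := by positivity
    refine le_of_mul_le_mul_left ?_ hk
    have h3 : c ^ 2 * (c ^ n)⁻¹ * ((p₀ + δ) * A - lam * N * (c ^ 2)⁻¹) =
        (p₀ + δ) * (c ^ 2 * ((c ^ n)⁻¹ * A)) - lam * ((c ^ n)⁻¹ * N) := by
      field_simp
    rw [h3]
    linarith
  have hlim : ∀ δ > 0, Slam Ω p q lam * (∫ x, |u x| ^ q) ^ (2 / q) ≤ (p₀ + δ) * A := by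
    intro δ hδ
    have ht : Tendsto (fun c : ℝ => (p₀ + δ) * A - lam * N * (c ^ 2)⁻¹) atTop
        (𝓝 ((p₀ + δ) * A - lam * N * 0)) :=
      tendsto_const_nhds.sub
        ((tendsto_inv_atTop_zero.comp (tendsto_pow_atTop two_ne_zero)).const_mul _)
    simpa using ge_of_tendsto ht (hev δ hδ)
  have ht : Tendsto (fun δ : ℝ => (p₀ + δ) * A) (𝓝[>] 0) (𝓝 ((p₀ + 0) * A)) :=
    Tendsto.mono_left (Continuous.tendsto (by fun_prop) 0) nhdsWithin_le_nhds
  simpa using ge_of_tendsto ht (eventually_mem_nhdsWithin.mono fun δ hδ => hlim δ hδ)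

end Weighted

end Auxiliary

theorem stmt_5 {n : ℕ} (hn : 3 ≤ n)
    (Ω : Set (Euc n)) (hΩo : IsOpen Ω) (hΩb : Bornology.IsBounded Ω)
    (a : Euc n) (ha : a ∈ Ω)
    (p : Euc n → ℝ) (hpc : ContinuousOn p (closure Ω))
    (p₀ : ℝ) (hp₀ : 0 < p₀) (hpa : p a = p₀) (hmin : ∀ x ∈ closure Ω, p₀ ≤ p x)
    (k β : ℝ) (hk : 0 < k) (hβ : 0 < β) (hA : CondA p a p₀ k β)
    (q : ℝ) (hq : q = 2 * (n : ℝ) / ((n : ℝ) - 2))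
    (lam : ℝ) (hlam : lam ≤ 0) :
    Slam Ω p q lam = p₀ * SobolevS Ω q ∧
    ∀ u : Euc n → ℝ, IsTest Ω u →
      p₀ * SobolevS Ω q * (∫ x in Ω, |u x| ^ q) ^ (2 / q) <
        (∫ x in Ω, p x * ‖gradient u x‖ ^ 2) - lam * ∫ x in Ω, (u x) ^ 2 := by
  have hn' : (3 : ℝ) ≤ n := by exact_mod_cast hn
  have hq2 : 2 < q := by
    rw [hq, lt_div_iff₀ (by linarith)]
    linarith
  have hq0 : 0 < q := by linarith
  obtain ⟨φ, hφ, hφc, hφΩ, hφ1, -⟩ :=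
    exists_smooth_cutoff hΩo (isCompact_singleton (x := a)) (Set.singleton_subset_iff.2 ha)
  have hφt : IsTest Ω φ := ⟨hφ, hφc, hφΩ, fun h => by simpa [h] using hφ1 a rfl⟩
  refine ⟨le_antisymm ?_ ?_, fun u hu => ?_⟩
  · rw [← div_le_iff₀' hp₀]
    refine le_csInf ⟨_, φ, hφt, rfl⟩ ?_
    rintro r ⟨u, hu, rfl⟩
    have hB := Real.rpow_pos_of_pos (hu.integral_abs_rpow_pos hq0) (2 / q)
    rw [hu.setIntegral_gradient, hu.setIntegral_abs_rpow hq0, div_le_iff₀' hp₀, ← mul_div_assoc,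
      le_div_iff₀ hB]
    exact hu.Slam_mul_le hn hq hq0 hΩo hΩb ha hpc hp₀.le hpa hmin hlam
  · refine le_csInf ⟨_, φ, hφt, rfl⟩ ?_
    rintro r ⟨u, hu, rfl⟩
    have hB := Real.rpow_pos_of_pos (hu.integral_abs_rpow_pos hq0) (2 / q)
    rw [hu.setIntegral_abs_rpow hq0, le_div_iff₀ hB, mul_assoc]
    exact (mul_le_mul_of_nonneg_left (hu.sobolev_le hq0) hp₀.le).trans
      (hu.le_energy hΩo hΩb hpc hmin hlam)
  · rw [hu.setIntegral_abs_rpow hq0, mul_assoc]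
    exact (mul_lt_mul_of_pos_left (hu.sobolev_lt (by omega) hΩo hq2) hp₀).trans_le
      (hu.le_energy hΩo hΩb hpc hmin hlam)
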